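/- arXiv:2111.07850 — 3 statements merged into one kernel-verified Lean document; each statement's English description precedes it below -/
import Mathlib

section
/- Let d ≥ 1, let Σ be a symmetric positive definite d×d real matrix, and let c, c' ∈ ℝ^d. Let μ = N(c, Σ) and μ' = N(c', Σ) be the multivariate Gaussian measures on ℝ^d with means c and c' and common covariance Σ. Then μ is absolutely continuous with respect to μ', and the Radon–Nikodym derivative satisfies, for μ'-almost every q, (dμ/dμ')(q) = exp( (c − c')ᵀ Σ⁻¹ (q − (c + c')/2) ). Equivalently, the privacy leakage function L(q) := log( (dμ/dμ')(q) ) equals (c − c')ᵀ Σ⁻¹ (q − c) + ½ (c − c')ᵀ Σ⁻¹ (c − c'). -/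
open MeasureTheory Matrix Real

/-- The multivariate Gaussian probability measure on `ℝ^d` with mean `m` and
(positive definite) covariance matrix `S`, defined via its density with respect
to Lebesgue measure: proportional to `exp (-½ (q - m)ᵀ S⁻¹ (q - m))`. -/
noncomputable def multivariateGaussian {d : ℕ} (m : Fin d → ℝ)
    (S : Matrix (Fin d) (Fin d) ℝ) : Measure (Fin d → ℝ) :=
  volume.withDensity fun q =>
    ENNReal.ofReal ((Real.sqrt ((2 * π) ^ d * S.det))⁻¹ *
      Real.exp (-(1 / 2) * ((q - m) ⬝ᵥ S⁻¹.mulVec (q - m))))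

/-- Completing the square: the log-density ratio of two Gaussians with common precision is
affine. -/
theorem quadForm_sub_add_bilin {d : ℕ} {A : Matrix (Fin d) (Fin d) ℝ} (hA : A.IsSymm)
    (c c' q : Fin d → ℝ) :
    -(1 / 2) * ((q - c') ⬝ᵥ A.mulVec (q - c')) + (c - c') ⬝ᵥ A.mulVec (q - (c + c') / 2) =
      -(1 / 2) * ((q - c) ⬝ᵥ A.mulVec (q - c)) := by
  have hsymm (x y : Fin d → ℝ) : x ⬝ᵥ A.mulVec y = y ⬝ᵥ A.mulVec x := by
    rw [dotProduct_mulVec, dotProduct_comm, ← mulVec_transpose, hA.eq]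
  have hmid : (c + c') / 2 = (1 / 2 : ℝ) • (c + c') := by
    ext i
    simp only [Pi.div_apply, Pi.ofNat_apply, Pi.smul_apply, smul_eq_mul]
    ring
  simp only [hmid, mulVec_sub, mulVec_add, mulVec_smul, dotProduct_sub, dotProduct_add,
    dotProduct_smul, sub_dotProduct, smul_eq_mul]
  rw [hsymm c q, hsymm c' q, hsymm c' c]
  ring

theorem bilin_sub_midpoint {d : ℕ} (A : Matrix (Fin d) (Fin d) ℝ) (c c' q : Fin d → ℝ) :
    (c - c') ⬝ᵥ A.mulVec (q - (c + c') / 2) =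
      (c - c') ⬝ᵥ A.mulVec (q - c) + (1 / 2) * ((c - c') ⬝ᵥ A.mulVec (c - c')) := by
  have hmid : q - (c + c') / 2 = (q - c) + (1 / 2 : ℝ) • (c - c') := by
    ext i
    simp only [Pi.div_apply, Pi.ofNat_apply, Pi.smul_apply, Pi.sub_apply, Pi.add_apply,
      smul_eq_mul]
    ring
  rw [hmid, mulVec_add, mulVec_smul, dotProduct_add, dotProduct_smul, smul_eq_mul]

instance sigmaFinite_multivariateGaussian {d : ℕ} (m : Fin d → ℝ)
    (S : Matrix (Fin d) (Fin d) ℝ) : SigmaFinite (multivariateGaussian m S) := by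
  unfold multivariateGaussian
  infer_instance

theorem multivariateGaussian_eq_withDensity {d : ℕ} {S : Matrix (Fin d) (Fin d) ℝ}
    (hS : S.IsSymm) (c c' : Fin d → ℝ) :
    multivariateGaussian c S = (multivariateGaussian c' S).withDensity fun q =>
      ENNReal.ofReal (Real.exp ((c - c') ⬝ᵥ S⁻¹.mulVec (q - (c + c') / 2))) := by
  have hA : S⁻¹.IsSymm := by rw [IsSymm, transpose_nonsing_inv, hS.eq]
  unfold multivariateGaussian
  rw [← withDensity_mul]
  · congr 1
    ext1 q
    rw [Pi.mul_apply, ← ENNReal.ofReal_mul (by positivity), mul_assoc, ← Real.exp_add,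
      quadForm_sub_add_bilin hA]
  · exact ENNReal.measurable_ofReal.comp (Continuous.measurable (by fun_prop))
  · exact ENNReal.measurable_ofReal.comp (Continuous.measurable (by fun_prop))

/-- For Gaussian measures `μ = N(c, S)` and `μ' = N(c', S)` with common symmetric
positive definite covariance `S`, `μ ≪ μ'` and the Radon–Nikodym derivative is
`(dμ/dμ')(q) = exp ((c - c')ᵀ S⁻¹ (q - (c + c')/2))` for `μ'`-a.e. `q`; equivalently
the privacy leakage `L(q) = log (dμ/dμ')(q)` equals
`(c - c')ᵀ S⁻¹ (q - c) + ½ (c - c')ᵀ S⁻¹ (c - c')`. -/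
theorem gaussian_rnDeriv_eq (d : ℕ) (hd : 1 ≤ d) (S : Matrix (Fin d) (Fin d) ℝ)
    (hS : S.PosDef) (c c' : Fin d → ℝ) :
    multivariateGaussian c S ≪ multivariateGaussian c' S ∧
    (∀ᵐ q ∂(multivariateGaussian c' S),
      (multivariateGaussian c S).rnDeriv (multivariateGaussian c' S) q =
        ENNReal.ofReal (Real.exp ((c - c') ⬝ᵥ S⁻¹.mulVec (q - (c + c') / 2)))) ∧
    (∀ᵐ q ∂(multivariateGaussian c' S),
      Real.log ((multivariateGaussian c S).rnDeriv (multivariateGaussian c' S) q).toReal =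
        (c - c') ⬝ᵥ S⁻¹.mulVec (q - c) +
          (1 / 2) * ((c - c') ⬝ᵥ S⁻¹.mulVec (c - c'))) := by
  have hμ := multivariateGaussian_eq_withDensity (isHermitian_iff_isSymm.mp hS.isHermitian) c c'
  have hderiv : ∀ᵐ q ∂(multivariateGaussian c' S),
      (multivariateGaussian c S).rnDeriv (multivariateGaussian c' S) q =
        ENNReal.ofReal (Real.exp ((c - c') ⬝ᵥ S⁻¹.mulVec (q - (c + c') / 2))) := by
    rw [hμ]
    exact Measure.rnDeriv_withDensity _ (ENNReal.measurable_ofReal.comp (Continuous.measurable (by fun_prop)))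
  refine ⟨hμ ▸ withDensity_absolutelyContinuous _ _, hderiv, ?_⟩
  filter_upwards [hderiv] with q hq
  rw [hq, ENNReal.toReal_ofReal (Real.exp_nonneg _), Real.log_exp, bilin_sub_midpoint]
end

section
/- Let ε > 0 and 0 < δ < 1 with ε ≤ 2·log 2, and let Δ > 0 satisfy Δ ≤ ε / √(2·log(2/δ)). Let Z be a real random variable with Gaussian distribution of mean Δ²/2 and variance Δ². Then P(Z > ε) ≤ δ. -/
open MeasureTheory ProbabilityTheory Real

/-- Calibration of the Gaussian mechanism: if `0 < ε ≤ 2 log 2`, `0 < δ < 1`, and the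
sensitivity `Δ > 0` satisfies `Δ ≤ ε / √(2 log (2/δ))`, then a Gaussian random
variable `Z` with mean `Δ²/2` and variance `Δ²` satisfies `P(Z > ε) ≤ δ`. -/
theorem gaussian_leakage_calibration (ε δ Δ : ℝ) (hε : 0 < ε) (hδ0 : 0 < δ) (hδ1 : δ < 1)
    (hεb : ε ≤ 2 * Real.log 2) (hΔ : 0 < Δ)
    (hcal : Δ ≤ ε / Real.sqrt (2 * Real.log (2 / δ))) :
    gaussianReal (Δ ^ 2 / 2) (Δ ^ 2).toNNReal {z | ε < z} ≤ ENNReal.ofReal δ := by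
  have hlog2 : 0 < Real.log 2 := Real.log_pos (by norm_num)
  have hL : Real.log (2 / δ) = Real.log 2 - Real.log δ := Real.log_div two_ne_zero hδ0.ne'
  have hlogδ : Real.log δ < 0 := Real.log_neg hδ0 hδ1
  have hLpos : 0 < 2 * Real.log (2 / δ) := by linarith
  have hD : 0 < Δ ^ 2 := by positivity
  have hcal_sq : Δ ^ 2 * (2 * (Real.log 2 - Real.log δ)) ≤ ε ^ 2 := by
    rw [le_div_iff₀ (Real.sqrt_pos.2 hLpos)] at hcal
    have h := pow_le_pow_left₀ (by positivity) hcal 2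
    rwa [mul_pow, Real.sq_sqrt hLpos.le, hL] at h
  have hDε : Δ ^ 2 ≤ ε := by
    have h1 : Δ ^ 2 * (2 * Real.log 2) ≤ ε * (2 * Real.log 2) := by nlinarith
    exact le_of_mul_le_mul_right h1 (by positivity)
  set t : ℝ := (ε - Δ ^ 2 / 2) / Δ ^ 2 with ht
  have ht0 : 0 ≤ t := div_nonneg (by linarith) hD.le
  have hexp : -t * ε + (Δ ^ 2 / 2 * t + Δ ^ 2 * t ^ 2 / 2) ≤ Real.log δ := by
    have h : -t * ε + (Δ ^ 2 / 2 * t + Δ ^ 2 * t ^ 2 / 2) =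
        -(ε - Δ ^ 2 / 2) ^ 2 / (2 * Δ ^ 2) := by
      rw [ht]; field_simp; ring
    rw [h, div_le_iff₀ (by positivity)]
    nlinarith [mul_le_mul_of_nonneg_right hεb hD.le, sq_nonneg (Δ ^ 2)]
  have hchernoff := measure_ge_le_exp_mul_mgf (μ := gaussianReal (Δ ^ 2 / 2) (Δ ^ 2).toNNReal)
    (X := id) ε ht0 (integrable_exp_mul_gaussianReal t)
  rw [mgf_id_gaussianReal, Real.coe_toNNReal _ hD.le, ← Real.exp_add] at hchernoff
  rw [← ofReal_measureReal]
  refine ENNReal.ofReal_le_ofReal ?_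
  calc (gaussianReal (Δ ^ 2 / 2) (Δ ^ 2).toNNReal).real {z | ε < z}
      ≤ (gaussianReal (Δ ^ 2 / 2) (Δ ^ 2).toNNReal).real {z | ε ≤ id z} :=
        measureReal_mono fun z (hz : ε < z) => hz.le
    _ ≤ Real.exp (-t * ε + (Δ ^ 2 / 2 * t + Δ ^ 2 * t ^ 2 / 2)) := hchernoff
    _ ≤ δ := (Real.exp_le_exp.2 hexp).trans_eq (Real.exp_log hδ0)
end

section
/- (Colored Gaussian mechanism is (ε,δ)-DP.) Let d ≥ 1, ε > 0, 0 < δ < 1 with ε ≤ 2·log 2. Let Γ be a symmetric positive definite d×d real matrix and let c, c' ∈ ℝ^d satisfy (c − c')ᵀ Γ (c − c') ≤ γ_c, where γ_c := ε² / (2·log(2/δ)). Let μ = N(c, Γ⁻¹) and μ' = N(c', Γ⁻¹) be the multivariate Gaussian measures with means c, c' and covariance Γ⁻¹. Then for every measurable set S ⊆ ℝ^d, μ(S) ≤ e^ε · μ'(S) + δ. -/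
open MeasureTheory Matrix Real

open ProbabilityTheory in
lemma lintegral_prod_gaussianPDFReal_eq_one (d : ℕ) :
    ∫⁻ q : Fin d → ℝ, ENNReal.ofReal (∏ i, gaussianPDFReal 0 1 (q i)) = 1 := by
  rw [← ofReal_integral_eq_lintegral_ofReal]
  · rw [integral_fintype_prod_volume_eq_pow, integral_gaussianPDFReal_eq_one 0 one_ne_zero]
    simp
  · exact Integrable.fintype_prod (μ := fun _ : Fin d => (volume : Measure ℝ))
      fun _ => integrable_gaussianPDFReal 0 1
  · exact ae_of_all _ fun q => Finset.prod_nonneg fun i _ => gaussianPDFReal_nonneg 0 1 (q i)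

open ProbabilityTheory in
lemma gaussian_density_eq_abs_det_mul_prod {d : ℕ} (B : Matrix (Fin d) (Fin d) ℝ) (v : Fin d → ℝ) :
    (Real.sqrt ((2 * π) ^ d * (Bᵀ * B)⁻¹.det))⁻¹ *
      Real.exp (-(1 / 2) * (v ⬝ᵥ (Bᵀ * B).mulVec v)) =
      |B.det| * ∏ i, gaussianPDFReal 0 1 (B.mulVec v i) := by
  have hq : v ⬝ᵥ (Bᵀ * B).mulVec v = ∑ i, (B.mulVec v i) ^ 2 := by
    rw [← mulVec_mulVec, dotProduct_mulVec, vecMul_transpose]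
    simp [dotProduct, sq]
  have hdet : Real.sqrt (Bᵀ * B)⁻¹.det = |B.det|⁻¹ := by
    rw [det_nonsing_inv, Ring.inverse_eq_inv', det_mul, det_transpose, Real.sqrt_inv, ← sq,
      Real.sqrt_sq_eq_abs]
  have hpow : Real.sqrt ((2 * π) ^ d) = Real.sqrt (2 * π) ^ d := by
    rw [Real.sqrt_eq_iff_mul_self_eq (by positivity) (by positivity), ← mul_pow,
      Real.mul_self_sqrt (by positivity)]
  rw [Real.sqrt_mul (by positivity), hdet, hpow, hq]
  simp only [gaussianPDFReal, NNReal.coe_one, mul_one, sub_zero, Finset.prod_mul_distrib,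
    Finset.prod_const, Finset.card_univ, Fintype.card_fin, ← Real.exp_sum]
  rw [mul_inv, inv_inv, Finset.mul_sum, inv_pow, mul_comm _ |B.det|, mul_assoc]
  congr 4
  ext i
  ring

lemma multivariateGaussian_inv_univ {d : ℕ} {Γ : Matrix (Fin d) (Fin d) ℝ} (hΓ : Γ.PosDef)
    (m : Fin d → ℝ) : multivariateGaussian m Γ⁻¹ Set.univ = 1 := by
  obtain ⟨B, hB⟩ : ∃ B : Matrix (Fin d) (Fin d) ℝ, Γ = Bᵀ * B := by
    open scoped MatrixOrder in
    obtain ⟨B, hB⟩ := CStarAlgebra.nonneg_iff_eq_star_mul_self.1 hΓ.posSemidef.nonneg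
    rw [star_eq_conjTranspose] at hB
    exact ⟨B, by rw [hB, conjTranspose_eq_transpose_of_trivial]⟩
  have hdet : B.det ≠ 0 := by
    intro h
    have := hΓ.det_pos
    simp [hB, h] at this
  have hmeas : Measurable fun q : Fin d → ℝ =>
      ENNReal.ofReal (∏ i, ProbabilityTheory.gaussianPDFReal 0 1 (q i)) := by fun_prop
  have hlin : Measurable (toLin' B) := (toLin' B).continuous_of_finiteDimensional.measurable
  rw [multivariateGaussian, withDensity_apply _ MeasurableSet.univ, Measure.restrict_univ]
  rw [nonsing_inv_nonsing_inv _ hΓ.det_pos.ne'.isUnit, hB]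
  simp only [gaussian_density_eq_abs_det_mul_prod, ENNReal.ofReal_mul (abs_nonneg B.det)]
  rw [lintegral_sub_right_eq_self (fun v => ENNReal.ofReal |B.det| *
    ENNReal.ofReal (∏ i, ProbabilityTheory.gaussianPDFReal 0 1 (B.mulVec v i))) m]
  have hmap := lintegral_map (μ := volume) hmeas hlin
  rw [Real.map_matrix_volume_pi_eq_smul_volume_pi hdet, lintegral_smul_measure,
    lintegral_prod_gaussianPDFReal_eq_one] at hmap
  simp only [toLin'_apply, smul_eq_mul, mul_one] at hmap
  rw [lintegral_const_mul' _ _ ENNReal.ofReal_ne_top, ← hmap,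
    ← ENNReal.ofReal_mul (abs_nonneg _), ← abs_mul, mul_inv_cancel₀ hdet]
  simp

lemma exp_neg_half_le_exp_mul_add_exp (a b ε t : ℝ) (ht : 0 ≤ t) :
    Real.exp (-(1 / 2) * a) ≤ Real.exp ε * Real.exp (-(1 / 2) * b) +
      Real.exp (-(1 / 2) * a + t * ((b - a) / 2 - ε)) := by
  rw [← Real.exp_add]
  rcases le_total ((b - a) / 2) ε with h | h
  · have : Real.exp (-(1 / 2) * a) ≤ Real.exp (ε + -(1 / 2) * b) :=
      Real.exp_le_exp.2 (by linarith)
    linarith [Real.exp_pos (-(1 / 2) * a + t * ((b - a) / 2 - ε))]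
  · have : Real.exp (-(1 / 2) * a) ≤ Real.exp (-(1 / 2) * a + t * ((b - a) / 2 - ε)) :=
      Real.exp_le_exp.2 (by nlinarith)
    linarith [Real.exp_pos (ε + -(1 / 2) * b)]

lemma dotProduct_mulVec_add_smul {d : ℕ} {Γ : Matrix (Fin d) (Fin d) ℝ} (hΓ : Γᵀ = Γ)
    (v w : Fin d → ℝ) (t : ℝ) :
    (v + t • w) ⬝ᵥ Γ.mulVec (v + t • w) =
      v ⬝ᵥ Γ.mulVec v + 2 * t * (v ⬝ᵥ Γ.mulVec w) + t ^ 2 * (w ⬝ᵥ Γ.mulVec w) := by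
  have hsymm : w ⬝ᵥ Γ.mulVec v = v ⬝ᵥ Γ.mulVec w := by
    rw [dotProduct_mulVec, ← mulVec_transpose, hΓ, dotProduct_comm]
  simp only [mulVec_add, mulVec_smul, dotProduct_add, add_dotProduct, smul_dotProduct,
    dotProduct_smul, smul_eq_mul, hsymm]
  ring

/-- Chernoff bound on the privacy loss of two Gaussian measures with common precision matrix. -/
lemma multivariateGaussian_le_exp_mul_add_chernoff {d : ℕ} {Γ : Matrix (Fin d) (Fin d) ℝ}
    (hΓ : Γ.PosDef) (c c' : Fin d → ℝ) (ε t : ℝ) (ht : 0 ≤ t) {S : Set (Fin d → ℝ)}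
    (hS : MeasurableSet S) :
    multivariateGaussian c Γ⁻¹ S ≤
      ENNReal.ofReal (Real.exp ε) * multivariateGaussian c' Γ⁻¹ S +
      ENNReal.ofReal
        (Real.exp (t * ((1 + t) / 2 * ((c - c') ⬝ᵥ Γ.mulVec (c - c')) - ε))) := by
  set s := (c - c') ⬝ᵥ Γ.mulVec (c - c') with hs
  set m := c + t • (c - c') with hm
  have hsymm : Γᵀ = Γ := by
    rw [← conjTranspose_eq_transpose_of_trivial]; exact hΓ.isHermitian
  have hle : multivariateGaussian m Γ⁻¹ S ≤ 1 :=
    (measure_mono (Set.subset_univ S)).trans (multivariateGaussian_inv_univ hΓ m).le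
  refine le_trans ?_ (add_le_add_right
    ((mul_le_mul_right hle (ENNReal.ofReal (Real.exp (t * ((1 + t) / 2 * s - ε))))).trans
      (mul_one _).le) _)
  simp only [multivariateGaussian, withDensity_apply _ hS,
    nonsing_inv_nonsing_inv _ hΓ.det_pos.ne'.isUnit]
  rw [← lintegral_const_mul' _ _ ENNReal.ofReal_ne_top,
    ← lintegral_const_mul' _ _ ENNReal.ofReal_ne_top, ← lintegral_add_left (by fun_prop)]
  refine lintegral_mono fun q => ?_
  rw [← ENNReal.ofReal_mul (by positivity), ← ENNReal.ofReal_mul (by positivity),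
    ← ENNReal.ofReal_add (by positivity) (by positivity)]
  refine ENNReal.ofReal_le_ofReal ?_
  have h1 := dotProduct_mulVec_add_smul hsymm (q - c) (c - c') 1
  have h2 := dotProduct_mulVec_add_smul hsymm (q - c) (c - c') (-t)
  rw [show q - c + (1 : ℝ) • (c - c') = q - c' by rw [one_smul]; abel] at h1
  rw [show q - c + (-t) • (c - c') = q - m by rw [hm, neg_smul]; abel] at h2
  have key := exp_neg_half_le_exp_mul_add_exp ((q - c) ⬝ᵥ Γ.mulVec (q - c))
    ((q - c') ⬝ᵥ Γ.mulVec (q - c')) ε t ht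
  have hexp : -(1 / 2) * ((q - c) ⬝ᵥ Γ.mulVec (q - c)) +
      t * (((q - c') ⬝ᵥ Γ.mulVec (q - c') - (q - c) ⬝ᵥ Γ.mulVec (q - c)) / 2 - ε) =
      t * ((1 + t) / 2 * s - ε) + -(1 / 2) * ((q - m) ⬝ᵥ Γ.mulVec (q - m)) := by
    rw [h1, h2, ← hs]; ring
  rw [hexp, Real.exp_add (t * _)] at key
  refine (mul_le_mul_of_nonneg_left key
    (inv_nonneg.2 (Real.sqrt_nonneg ((2 * π) ^ d * Γ⁻¹.det)))).trans_eq ?_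
  ring

lemma exists_chernoff_parameter {ε δ s : ℝ} (hε : 0 < ε) (hδ0 : 0 < δ) (hδ1 : δ < 1)
    (hεb : ε ≤ 2 * Real.log 2) (hs : 0 < s) (hcal : s ≤ ε ^ 2 / (2 * Real.log (2 / δ))) :
    ∃ t, 0 ≤ t ∧ Real.exp (t * ((1 + t) / 2 * s - ε)) ≤ δ := by
  have hK : Real.log (2 / δ) = Real.log 2 - Real.log δ := Real.log_div (by norm_num) hδ0.ne'
  have hlog : Real.log δ < 0 := Real.log_neg hδ0 hδ1
  have hlog2 : 0 < Real.log 2 := Real.log_pos (by norm_num)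
  have hKpos : 0 < Real.log (2 / δ) := by linarith
  rw [le_div_iff₀ (by positivity)] at hcal
  have hsε : s ≤ 2 * ε := by
    by_contra! h
    nlinarith
  refine ⟨ε / s - 1 / 2, ?_, ?_⟩
  · rw [sub_nonneg, div_le_div_iff₀ (by norm_num) hs]; linarith
  · rw [← Real.le_log_iff_exp_le hδ0]
    have hmain : Real.log (2 / δ) ≤ ε ^ 2 / s / 2 := by
      rw [div_div, le_div_iff₀ (by positivity)]; linarith
    have heq : (ε / s - 1 / 2) * ((1 + (ε / s - 1 / 2)) / 2 * s - ε) =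
        -(ε ^ 2 / s / 2) + ε / 2 - s / 8 := by
      field_simp; ring
    rw [heq]
    linarith

/-- The colored Gaussian noise mechanism is `(ε,δ)`-DP: if the precision matrix `Γ`
is symmetric positive definite and `(c - c')ᵀ Γ (c - c') ≤ γ_c := ε²/(2 log (2/δ))`,
then the Gaussian measures `N(c, Γ⁻¹)` and `N(c', Γ⁻¹)` satisfy
`μ S ≤ e^ε μ' S + δ` for every measurable `S`. -/
theorem colored_gaussian_mechanism_dp (d : ℕ) (hd : 1 ≤ d) (ε δ : ℝ)
    (hε : 0 < ε) (hδ0 : 0 < δ) (hδ1 : δ < 1) (hεb : ε ≤ 2 * Real.log 2)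
    (Γ : Matrix (Fin d) (Fin d) ℝ) (hΓ : Γ.PosDef) (c c' : Fin d → ℝ)
    (hcal : (c - c') ⬝ᵥ Γ.mulVec (c - c') ≤ ε ^ 2 / (2 * Real.log (2 / δ))) :
    ∀ S : Set (Fin d → ℝ), MeasurableSet S →
      multivariateGaussian c Γ⁻¹ S ≤
        ENNReal.ofReal (Real.exp ε) * multivariateGaussian c' Γ⁻¹ S +
        ENNReal.ofReal δ := by
  intro S hS
  rcases eq_or_ne c c' with rfl | hne
  · refine le_add_right (le_mul_of_one_le_left' ?_)
    exact ENNReal.one_le_ofReal.2 (Real.one_le_exp hε.le)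
  · have hs : 0 < (c - c') ⬝ᵥ Γ.mulVec (c - c') := by
      simpa using hΓ.dotProduct_mulVec_pos (sub_ne_zero.2 hne)
    obtain ⟨t, ht, hle⟩ := exists_chernoff_parameter hε hδ0 hδ1 hεb hs hcal
    exact (multivariateGaussian_le_exp_mul_add_chernoff hΓ c c' ε t ht hS).trans
      (add_le_add_right (ENNReal.ofReal_le_ofReal hle) _)
end
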